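/- Theorem 2 (bound on posterior dimension). Under the clipped GLM setup, suppose a_n > 1, λ_n satisfies Assumption L₀, n, d_n → ∞ with d_n > n, n is large enough that b_n log d_n < n, and the IC(Model) and IC(Joint) assumptions hold with non-empty B_n. Then sup_{β* ∈ B_n} E[ Π_n( |supp(β)| > s_n* [ 1 + (8/(a_n − 1)) (1 + 49 M(A,X)²/(8 φ₁(A,X,S*)²)) ] | Y^{(n)} ) ] → 0 as n → ∞, where the expectation is with respect to the true data-generating distribution. -/

import Mathlib

open MeasureTheory Real Filter

noncomputable section

/-- Density of a one-parameter canonical exponential family member with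
canonical parameter `θ`, base function `h`, sufficient statistic `T` and
log-partition function `A`. -/
def expFamDensity (h T A : ℝ → ℝ) (θ : ℝ) (y : ℝ) : ℝ :=
  h y * Real.exp (θ * T y - A θ)

/-- The exponential family member as a measure on `ℝ`. -/
def expFamMeasure (μ : Measure ℝ) (h T A : ℝ → ℝ) (θ : ℝ) : Measure ℝ :=
  μ.withDensity fun y => ENNReal.ofReal (expFamDensity h T A θ y)

/-- Joint distribution of `n` independent observations with parameters `θ i`. -/
def dataMeasure (μ : Measure ℝ) (h T A : ℝ → ℝ) (n : ℕ) (θ : Fin n → ℝ) :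
    Measure (Fin n → ℝ) :=
  Measure.pi fun i => expFamMeasure μ h T A (θ i)

/-- The ℓ₁ norm on `ℝ^m`. -/
def l1 {m : ℕ} (v : Fin m → ℝ) : ℝ := ∑ j, |v j|

/-- The support (set of nonzero coordinates) of a vector. -/
def suppSet {m : ℕ} (v : Fin m → ℝ) : Finset (Fin m) :=
  Finset.univ.filter fun j => v j ≠ 0

/-- `restr S v` agrees with `v` on `S` and is zero off `S`. -/
def restr {m : ℕ} (S : Finset (Fin m)) (v : Fin m → ℝ) : Fin m → ℝ :=
  fun j => if j ∈ S then v j else 0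

/-- The Laplace distribution with rate `lam` as a measure on `ℝ`. -/
def laplaceMeasure (lam : ℝ) : Measure ℝ :=
  volume.withDensity fun x => ENNReal.ofReal (lam / 2 * Real.exp (-(lam * |x|)))

/-- Given a model `S`, independent Laplace coordinates on `S` and point
masses at zero off `S`. -/
def modelMeasure (dn : ℕ) (lam : ℝ) (S : Finset (Fin dn)) : Measure (Fin dn → ℝ) :=
  Measure.pi fun j => if j ∈ S then laplaceMeasure lam else Measure.dirac 0

/-- The spike-and-Laplace complexity prior `Π_n` on `ℝ^{d_n}` with
hyperparameters `lam = λ_n`, `a = a_n` and normalizer `C = C_n`. -/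
def priorMeasure (dn : ℕ) (lam a C : ℝ) : Measure (Fin dn → ℝ) :=
  ∑ S : Finset (Fin dn),
    ENNReal.ofReal (C * ((dn.choose S.card : ℝ))⁻¹ * ((dn : ℝ) ^ (-a)) ^ S.card) •
      modelMeasure dn lam S

/-- `η_i = η(x_iᵀ β)`. -/
def etaVec (ηf : ℝ → ℝ) {n dn : ℕ} (X : Matrix (Fin n) (Fin dn) ℝ) (β : Fin dn → ℝ)
    (i : Fin n) : ℝ :=
  ηf (∑ j, X i j * β j)

/-- The Kullback--Leibler divergence `D_n(θ* ‖ θ)`, expressed as the Bregman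
divergence of the log-partition function. -/
def klDiv (A : ℝ → ℝ) {n : ℕ} (θstar θ : Fin n → ℝ) : ℝ :=
  ∑ i, (A (θ i) - A (θstar i) - (θ i - θstar i) * deriv A (θstar i))

/-- The centered stochastic term `Z_n(θ, θ*)`; `ET i` is the mean of `T(y_i)`. -/
def centeredZ (T : ℝ → ℝ) {n : ℕ} (ET θstar θ : Fin n → ℝ) (y : Fin n → ℝ) : ℝ :=
  ∑ i, (T (y i) - ET i) * (θ i - θstar i)

/-- The log-likelihood ratio `L_n(η, η*) = Z_n(η, η*) - D_n(η* ‖ η)`. -/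
def logLR (μ : Measure ℝ) (h T A ηf : ℝ → ℝ) {n dn : ℕ} (X : Matrix (Fin n) (Fin dn) ℝ)
    (βstar β : Fin dn → ℝ) (y : Fin n → ℝ) : ℝ :=
  centeredZ T (fun i => ∫ z, T z ∂(expFamMeasure μ h T A (etaVec ηf X βstar i)))
      (etaVec ηf X βstar) (etaVec ηf X β) y
    - klDiv A (etaVec ηf X βstar) (etaVec ηf X β)

/-- The marginal likelihood `∫ exp(L_n(η,η*)) dΠ_n(β)`. -/
def marginalLik (μ : Measure ℝ) (h T A ηf : ℝ → ℝ) {n : ℕ} (dn : ℕ)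
    (X : Matrix (Fin n) (Fin dn) ℝ) (βstar : Fin dn → ℝ) (lam a C : ℝ)
    (y : Fin n → ℝ) : ℝ :=
  ∫ β, Real.exp (logLR μ h T A ηf X βstar β y) ∂(priorMeasure dn lam a C)

/-- The posterior probability of a set `B` given data `y`. -/
def posterior (μ : Measure ℝ) (h T A ηf : ℝ → ℝ) {n : ℕ} (dn : ℕ)
    (X : Matrix (Fin n) (Fin dn) ℝ) (βstar : Fin dn → ℝ) (lam a C : ℝ)
    (B : Set (Fin dn → ℝ)) (y : Fin n → ℝ) : ℝ :=
  (∫ β in B, Real.exp (logLR μ h T A ηf X βstar β y) ∂(priorMeasure dn lam a C)) /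
    marginalLik μ h T A ηf dn X βstar lam a C y

/-- `‖X‖_{(∞,∞)} = max_{i,j} |X_{ij}|`. -/
def Xnorm {n dn : ℕ} (X : Matrix (Fin n) (Fin dn) ℝ) : ℝ := ⨆ i, ⨆ j, |X i j|

/-- `M(A, X) = ‖X‖_{(∞,∞)} · M₁(A)` with `M₁(A) = (1 ⊓ M₀(A)⁻¹)⁻¹`. -/
def Mconst (M0 : ℝ) {n dn : ℕ} (X : Matrix (Fin n) (Fin dn) ℝ) : ℝ :=
  Xnorm X * (min 1 M0⁻¹)⁻¹

/-- `B_n = B_{1,n} ∩ B_{2,n}`: vectors whose support has positive compatibility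
constant and whose sparsity is positive and at most `b_n`. -/
def Bset (d : ℕ → ℕ) (b : ℕ → ℝ) (φ1 : ∀ n : ℕ, Finset (Fin (d n)) → ℝ) (n : ℕ) :
    Set (Fin (d n) → ℝ) :=
  {β | 0 < φ1 n (suppSet β) ∧ 0 < (suppSet β).card ∧ ((suppSet β).card : ℝ) ≤ b n}

open ProbabilityTheory in
lemma integrable_exp_of_logPartition {ν : Measure ℝ} {T A : ℝ → ℝ} {θ : ℝ}
    (hθ : Real.exp (A θ) = mgf T ν θ) : θ ∈ integrableExpSet T ν := by
  by_contra hc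
  rw [mgf_undef hc] at hθ
  exact (Real.exp_pos _).ne' hθ

/-- The base measure `h · μ` of the exponential family. -/
def baseMeasure (μ : Measure ℝ) (h : ℝ → ℝ) : Measure ℝ :=
  μ.withDensity fun y => ENNReal.ofReal (h y)

open ProbabilityTheory in
lemma mgf_baseMeasure (μ : Measure ℝ) {h : ℝ → ℝ} (hhpos : ∀ y, 0 ≤ h y) (hmh : Measurable h)
    (T : ℝ → ℝ) (θ : ℝ) :
    mgf T (baseMeasure μ h) θ = ∫ y, h y * Real.exp (θ * T y) ∂μ := by
  rw [mgf, baseMeasure, integral_withDensity_eq_integral_toReal_smul (by fun_prop) (by simp)]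
  simp [ENNReal.toReal_ofReal, hhpos]

lemma expFamMeasure_eq_tilted (μ : Measure ℝ) {h T A : ℝ → ℝ} (hhpos : ∀ y, 0 ≤ h y)
    (hmh : Measurable h) (hmT : Measurable T) {θ : ℝ}
    (hθ : Real.exp (A θ) = ∫ y, h y * Real.exp (θ * T y) ∂μ) :
    expFamMeasure μ h T A θ = (baseMeasure μ h).tilted (fun y => θ * T y) := by
  have h1 := mgf_baseMeasure μ hhpos hmh T θ
  rw [ProbabilityTheory.mgf] at h1
  rw [Measure.tilted, h1, ← hθ, baseMeasure, ← withDensity_mul _ (by fun_prop) (by fun_prop),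
    expFamMeasure]
  congr 1
  ext y
  simp only [expFamDensity, Pi.mul_apply]
  rw [← ENNReal.ofReal_mul (hhpos y), Real.exp_sub]

open ProbabilityTheory in
/-- Mean and variance of the sufficient statistic at an interior parameter. -/
lemma expFam_mean_variance (μ : Measure ℝ) {h T A : ℝ → ℝ} {domA : Set ℝ}
    (hhpos : ∀ y, 0 ≤ h y) (hmh : Measurable h) (hmT : Measurable T)
    (hlogpart : ∀ θ ∈ domA, Real.exp (A θ) = ∫ y, h y * Real.exp (θ * T y) ∂μ)
    {θ : ℝ} (hθ : θ ∈ interior domA) :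
    ∫ y, T y ∂(expFamMeasure μ h T A θ) = deriv A θ ∧
    ∫⁻ y, ENNReal.ofReal ((T y - ∫ z, T z ∂(expFamMeasure μ h T A θ)) ^ 2)
      ∂(expFamMeasure μ h T A θ) = ENNReal.ofReal (deriv (deriv A) θ) := by
  have hm : ∀ t ∈ domA, Real.exp (A t) = mgf T (baseMeasure μ h) t := fun t ht => by
    rw [mgf_baseMeasure μ hhpos hmh, hlogpart t ht]
  have hsub : domA ⊆ integrableExpSet T (baseMeasure μ h) := fun t ht =>
    integrable_exp_of_logPartition (hm t ht)
  have hint : θ ∈ interior (integrableExpSet T (baseMeasure μ h)) := interior_mono hsub hθ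
  have hA : A =ᶠ[nhds θ] cgf T (baseMeasure μ h) := by
    filter_upwards [isOpen_interior.mem_nhds hθ] with t ht
    rw [cgf, ← hm t (interior_subset ht), Real.log_exp]
  rw [expFamMeasure_eq_tilted μ hhpos hmh hmT (hlogpart θ (interior_subset hθ))]
  have h1 := integral_tilted_mul_self hint
  refine ⟨h1.trans hA.deriv_eq.symm, ?_⟩
  have hL := memLp_tilted_mul hint 2
  have h2 := variance_tilted_mul hint
  rw [← ofReal_integral_eq_lintegral_ofReal, ← variance_eq_integral hmT.aemeasurable, h2,
    iteratedDeriv_succ, iteratedDeriv_one, hA.deriv.deriv_eq]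
  · exact (hL.sub (memLp_const _)).integrable_sq
  · filter_upwards with y using by positivity

/-- Every value of an injective continuous function into `s` is interior to `s`. -/
lemma mem_interior_of_injective_continuous {f : ℝ → ℝ} (hf : Continuous f)
    (hinj : Function.Injective f) {s : Set ℝ} (hs : Convex ℝ s) (hr : ∀ t, f t ∈ s) (t : ℝ) :
    f t ∈ interior s := by
  have key : ∀ x y, f x < f t → f t < f y → f t ∈ interior s := fun x y hx hy => by
    refine interior_mono (hs.ordConnected.out (hr x) (hr y)) ?_
    rw [interior_Icc]
    exact ⟨hx, hy⟩
  rcases hf.strictMono_of_inj hinj with hm | hm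
  · exact key (t - 1) (t + 1) (hm (by linarith)) (hm (by linarith))
  · exact key (t + 1) (t - 1) (hm (by linarith)) (hm (by linarith))

/-- Quadratic upper bound for the Bregman divergence. -/
lemma bregman_le {A : ℝ → ℝ} {s J : Set ℝ} (hJ : J.OrdConnected) (hJs : J ⊆ interior s)
    (hsmooth : ContDiffOn ℝ 2 A s) {c : ℝ}
    (hc : ∀ t ∈ J, 0 ≤ deriv (deriv A) t ∧ deriv (deriv A) t ≤ c) {x y : ℝ} (hx : x ∈ J)
    (hy : y ∈ J) : A y - A x - (y - x) * deriv A x ≤ c * (y - x) ^ 2 := by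
  have hcd : ∀ t ∈ J, ContDiffAt ℝ 2 A t := fun t ht =>
    (hsmooth t (interior_subset (hJs ht))).contDiffAt (mem_interior_iff_mem_nhds.1 (hJs ht))
  have hdA : ∀ t ∈ J, DifferentiableAt ℝ A t := fun t ht => (hcd t ht).differentiableAt (by simp)
  have hdA' : ∀ t ∈ J, DifferentiableAt ℝ (deriv A) t := fun t ht =>
    ((hcd t ht).derivWithin (m := 1) (by norm_num)).differentiableAt (by simp)
  have hcx : Convex ℝ J := hJ.convex
  have hlip : ∀ u ∈ Set.uIcc x y, |deriv A u - deriv A x| ≤ c * |y - x| := by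
    intro u hu
    have huJ : u ∈ J := hJ.uIcc_subset hx hy hu
    have := hcx.norm_image_sub_le_of_norm_deriv_le (f := deriv A) (C := c) hdA'
      (fun t ht => by rw [Real.norm_eq_abs, abs_of_nonneg (hc t ht).1]; exact (hc t ht).2) hx huJ
    refine this.trans ?_
    have h0 : 0 ≤ c := (hc x hx).1.trans (hc x hx).2
    gcongr
    exact Set.abs_sub_left_of_mem_uIcc hu
  have := (convex_uIcc x y).norm_image_sub_le_of_norm_deriv_le (f := fun u => A u - u * deriv A x)
    (C := c * |y - x|) (x := x) (y := y)
    (fun u hu => ((hdA u (hJ.uIcc_subset hx hy hu)).sub (by fun_prop))) (fun u hu => by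
      rw [deriv_fun_sub (hdA u (hJ.uIcc_subset hx hy hu)) (by fun_prop)]
      simpa using hlip u hu) (by simp) (by simp)
  have h2 := (le_abs_self _).trans this
  rw [Real.norm_eq_abs] at h2
  have h3 : c * |y - x| * |y - x| = c * (y - x) ^ 2 := by rw [mul_assoc, abs_mul_abs_self]; ring
  linarith

lemma lintegral_fin_prod_eq_prod {n : ℕ} {E : Type*} [MeasurableSpace E]
    (μ : Fin n → Measure E) [∀ i, SigmaFinite (μ i)]
    {f : Fin n → E → ENNReal} (hf : ∀ i, Measurable (f i)) :
    ∫⁻ x, ∏ i, f i (x i) ∂(Measure.pi μ) = ∏ i, ∫⁻ x, f i x ∂(μ i) := by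
  induction n with
  | zero => simp
  | succ n ih =>
    have hmeas : Measurable fun x : Fin n → E => ∏ i, f (Fin.succ i) (x i) :=
      Finset.measurable_prod _ fun i _ => (hf _).comp (measurable_pi_apply i)
    rw [← ((measurePreserving_piFinSuccAbove μ 0).symm).lintegral_comp_emb
      (MeasurableEquiv.measurableEmbedding _)]
    simp_rw [MeasurableEquiv.piFinSuccAbove_symm_apply, Fin.insertNthEquiv,
      Fin.prod_univ_succ, Fin.insertNth_zero]
    rw [← ih (fun i => μ i.succ) (fun i => hf i.succ)]
    exact lintegral_prod_mul (hf 0).aemeasurable hmeas.aemeasurable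

instance laplaceMeasure_sigmaFinite (lam : ℝ) : SigmaFinite (laplaceMeasure lam) := by
  rw [laplaceMeasure]
  exact SigmaFinite.withDensity_ofReal _

instance modelFactor_sigmaFinite {dn : ℕ} (lam : ℝ) (S : Finset (Fin dn)) (j : Fin dn) :
    SigmaFinite (if j ∈ S then laplaceMeasure lam else Measure.dirac 0) := by
  split_ifs <;> infer_instance

lemma lintegral_exp_neg_abs_le {c : ℝ} (hc : 0 < c) (b : ℝ) :
    ∫⁻ x, ENNReal.ofReal (c * Real.exp (-(c * |x - b|))) = 2 := by
  rw [lintegral_sub_right_eq_self (fun x => ENNReal.ofReal (c * Real.exp (-(c * |x|)))) b]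
  have h1 : ∫ x in Set.Ioi (0 : ℝ), c * Real.exp (-(c * x)) = 1 := by
    rw [integral_const_mul]
    have := integral_exp_mul_Ioi (a := -c) (by linarith) 0
    simp only [neg_mul] at this
    rw [this]
    field_simp
    simp
  have h2 : IntegrableOn (fun x : ℝ => c * Real.exp (-(c * x))) (Set.Ioi 0) := by
    by_contra hcon
    rw [integral_undef hcon] at h1
    exact zero_ne_one h1
  have h3 := integral_comp_abs (f := fun x => c * Real.exp (-(c * x)))
  rw [h1] at h3
  have h4 : Integrable (fun x : ℝ => c * Real.exp (-(c * |x|))) := by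
    by_contra hcon
    rw [integral_undef hcon] at h3
    norm_num at h3
  rw [← ofReal_integral_eq_lintegral_ofReal h4 (ae_of_all _ fun x => by positivity), h3]
  norm_num

/-- The Laplace law recentred at `b` at half the rate. -/
lemma lintegral_laplaceMeasure_recentred {lam : ℝ} (hlam : 0 < lam) (b : ℝ) :
    ∫⁻ x, ENNReal.ofReal (Real.exp (lam * |x| - lam / 2 * |x - b|)) ∂(laplaceMeasure lam) = 2 := by
  rw [laplaceMeasure, lintegral_withDensity_eq_lintegral_mul _ (by fun_prop) (by fun_prop)]
  rw [← lintegral_exp_neg_abs_le (half_pos hlam) b]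
  congr 1
  ext x
  rw [Pi.mul_apply, ← ENNReal.ofReal_mul (by positivity), mul_assoc, ← Real.exp_add]
  ring_nf

lemma lintegral_modelMeasure_recentred_le {dn : ℕ} {lam : ℝ} (hlam : 0 < lam)
    (S : Finset (Fin dn)) (b : Fin dn → ℝ) :
    ∫⁻ β, ENNReal.ofReal (Real.exp (lam * l1 β - lam / 2 * l1 (β - b))) ∂(modelMeasure dn lam S)
      ≤ 2 ^ S.card := by
  have h1 : ∀ β : Fin dn → ℝ, ENNReal.ofReal (Real.exp (lam * l1 β - lam / 2 * l1 (β - b)))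
      = ∏ j, ENNReal.ofReal (Real.exp (lam * |β j| - lam / 2 * |β j - b j|)) := fun β => by
    rw [← ENNReal.ofReal_prod_of_nonneg (fun _ _ => by positivity), ← Real.exp_sum]
    simp [l1, Finset.mul_sum, Finset.sum_sub_distrib]
  simp_rw [h1]
  rw [modelMeasure, lintegral_fin_prod_eq_prod _
    (f := fun j x => ENNReal.ofReal (Real.exp (lam * |x| - lam / 2 * |x - b j|)))
    (fun j => by fun_prop)]
  calc _ ≤ ∏ j : Fin dn, (if j ∈ S then (2 : ENNReal) else 1) := by
        refine Finset.prod_le_prod' fun j _ => ?_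
        split_ifs with hj
        · exact (lintegral_laplaceMeasure_recentred hlam (b j)).le
        · rw [lintegral_dirac' _ (by fun_prop)]
          rw [ENNReal.ofReal_le_one, Real.exp_le_one_iff]
          simp only [abs_zero, mul_zero, zero_sub, abs_neg]
          have := abs_nonneg (b j)
          nlinarith
    _ = 2 ^ S.card := by simp

/-- Box of half-width `r` around `b` inside the coordinate subspace of `S`. -/
def modelBox {dn : ℕ} (S : Finset (Fin dn)) (b : Fin dn → ℝ) (r : ℝ) : Set (Fin dn → ℝ) :=
  Set.univ.pi fun j => if j ∈ S then Set.Icc (b j - r) (b j + r) else {0}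

lemma measurableSet_modelBox {dn : ℕ} (S : Finset (Fin dn)) (b : Fin dn → ℝ) (r : ℝ) :
    MeasurableSet (modelBox S b r) := by
  refine MeasurableSet.univ_pi fun j => ?_
  split_ifs
  · exact measurableSet_Icc
  · exact measurableSet_singleton 0

lemma le_laplaceMeasure_Icc {lam r : ℝ} (hlam : 0 < lam) (b : ℝ) :
    ENNReal.ofReal (lam * r * Real.exp (-(lam * r)) * Real.exp (-(lam * |b|))) ≤
      laplaceMeasure lam (Set.Icc (b - r) (b + r)) := by
  rw [laplaceMeasure, withDensity_apply _ measurableSet_Icc]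
  calc _ = ∫⁻ _x in Set.Icc (b - r) (b + r),
        ENNReal.ofReal (lam / 2 * Real.exp (-(lam * (|b| + r)))) := by
        rw [setLIntegral_const, Real.volume_Icc, ← ENNReal.ofReal_mul (by positivity)]
        congr 1
        rw [mul_assoc, ← Real.exp_add]
        ring_nf
    _ ≤ _ := by
        refine setLIntegral_mono (by fun_prop) fun x hx => ENNReal.ofReal_le_ofReal ?_
        have h1 : |x| ≤ |b| + r := by
          have h2 : |x - b| ≤ r := abs_le.2 ⟨by linarith [hx.1], by linarith [hx.2]⟩
          have h3 := abs_add_le b (x - b)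
          rw [add_sub_cancel] at h3
          linarith
        gcongr

lemma le_modelMeasure_modelBox {dn : ℕ} {lam r : ℝ} (hlam : 0 < lam) (hr : 0 ≤ r)
    (S : Finset (Fin dn)) {b : Fin dn → ℝ} (hb : ∀ j ∉ S, b j = 0) :
    ENNReal.ofReal ((lam * r * Real.exp (-(lam * r))) ^ S.card * Real.exp (-(lam * l1 b))) ≤
      modelMeasure dn lam S (modelBox S b r) := by
  rw [modelMeasure, modelBox, Measure.pi_pi]
  calc _ = ∏ j, ENNReal.ofReal ((if j ∈ S then lam * r * Real.exp (-(lam * r)) else 1) *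
          Real.exp (-(lam * |b j|))) := by
        rw [← ENNReal.ofReal_prod_of_nonneg
          (fun j _ => by split_ifs <;> positivity), Finset.prod_mul_distrib, ← Real.exp_sum]
        simp [l1, Finset.mul_sum]
    _ ≤ _ := by
        refine Finset.prod_le_prod' fun j _ => ?_
        split_ifs with hj
        · exact le_laplaceMeasure_Icc hlam (b j)
        · simp [hb j hj]

/-- The likelihood ratio integrates to at most one under the true law. -/
lemma lintegral_exp_logLR_le (μ : Measure ℝ) {h T A ηf : ℝ → ℝ} (hhpos : ∀ y, 0 ≤ h y)
    (hmh : Measurable h) (hmT : Measurable T)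
    (hprob : ∀ t, IsProbabilityMeasure (expFamMeasure μ h T A (ηf t)))
    (hmean : ∀ t, ∫ y, T y ∂(expFamMeasure μ h T A (ηf t)) = deriv A (ηf t))
    {n dn : ℕ} (X : Matrix (Fin n) (Fin dn) ℝ) (βs β : Fin dn → ℝ) :
    ∫⁻ y, ENNReal.ofReal (Real.exp (logLR μ h T A ηf X βs β y))
      ∂(dataMeasure μ h T A n (etaVec ηf X βs)) ≤ 1 := by
  set θs := etaVec ηf X βs with hθs
  set θ := etaVec ηf X β with hθ
  have : ∀ i, IsProbabilityMeasure (expFamMeasure μ h T A (θs i)) := fun i => hprob _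
  have h1 : ∀ y, ENNReal.ofReal (Real.exp (logLR μ h T A ηf X βs β y)) =
      ∏ i, ENNReal.ofReal (Real.exp (T (y i) * (θ i - θs i) - (A (θ i) - A (θs i)))) := fun y => by
    rw [← ENNReal.ofReal_prod_of_nonneg (fun _ _ => by positivity), ← Real.exp_sum, logLR,
      centeredZ, klDiv, ← Finset.sum_sub_distrib]
    congr 2
    refine Finset.sum_congr rfl fun i _ => ?_
    have : ∫ z, T z ∂(expFamMeasure μ h T A (etaVec ηf X βs i)) = deriv A (θs i) := hmean _
    rw [this]
    ring
  simp_rw [h1]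
  rw [dataMeasure, lintegral_fin_prod_eq_prod _
    (f := fun i x => ENNReal.ofReal (Real.exp (T x * (θ i - θs i) - (A (θ i) - A (θs i)))))
    (fun i => by fun_prop)]
  refine Finset.prod_le_one' fun i _ => le_of_eq ?_
  have h2 : expFamMeasure μ h T A (θ i) Set.univ = 1 := (hprob _).measure_univ
  rw [expFamMeasure, withDensity_apply _ MeasurableSet.univ, setLIntegral_univ] at h2
  rw [← h2, expFamMeasure, lintegral_withDensity_eq_lintegral_mul _
    (by unfold expFamDensity; fun_prop) (by fun_prop)]
  congr 1
  ext x
  rw [Pi.mul_apply, expFamDensity, expFamDensity,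
    ← ENNReal.ofReal_mul (mul_nonneg (hhpos x) (Real.exp_nonneg _)), mul_assoc, ← Real.exp_add]
  ring_nf

lemma abs_le_Xnorm {n dn : ℕ} (X : Matrix (Fin n) (Fin dn) ℝ) (i : Fin n) (j : Fin dn) :
    |X i j| ≤ Xnorm X :=
  (le_ciSup (f := fun j => |X i j|) (Finite.bddAbove_range _) j).trans
    (le_ciSup (f := fun i => ⨆ j, |X i j|) (Finite.bddAbove_range _) i)

lemma Xnorm_nonneg {n dn : ℕ} (X : Matrix (Fin n) (Fin dn) ℝ) : 0 ≤ Xnorm X :=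
  Real.iSup_nonneg fun _ => Real.iSup_nonneg fun _ => abs_nonneg _

lemma l1_nonneg {m : ℕ} (v : Fin m → ℝ) : 0 ≤ l1 v := Finset.sum_nonneg fun _ _ => abs_nonneg _

lemma abs_etaVec_sub_le {ηf : ℝ → ℝ} (hlip : LipschitzWith 1 ηf) {n dn : ℕ}
    (X : Matrix (Fin n) (Fin dn) ℝ) (βs β : Fin dn → ℝ) (i : Fin n) :
    |etaVec ηf X β i - etaVec ηf X βs i| ≤ Xnorm X * l1 (β - βs) := by
  have h1 := hlip.dist_le_mul (∑ j, X i j * β j) (∑ j, X i j * βs j)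
  rw [Real.dist_eq, Real.dist_eq, NNReal.coe_one, one_mul, ← Finset.sum_sub_distrib] at h1
  refine h1.trans ((Finset.abs_sum_le_sum_abs _ _).trans ?_)
  rw [l1, Finset.mul_sum]
  refine Finset.sum_le_sum fun j _ => ?_
  rw [← mul_sub, abs_mul, Pi.sub_apply]
  gcongr
  exact abs_le_Xnorm X i j

lemma sum_etaVec_sub_sq_le {ηf : ℝ → ℝ} (hlip : LipschitzWith 1 ηf) {n dn : ℕ}
    (X : Matrix (Fin n) (Fin dn) ℝ) (βs β : Fin dn → ℝ) :
    ∑ i, (etaVec ηf X β i - etaVec ηf X βs i) ^ 2 ≤ n * (Xnorm X * l1 (β - βs)) ^ 2 := by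
  calc _ ≤ ∑ _i : Fin n, (Xnorm X * l1 (β - βs)) ^ 2 := Finset.sum_le_sum fun i _ => by
        rw [← sq_abs]
        gcongr
        exact abs_etaVec_sub_le hlip X βs β i
    _ = _ := by simp

lemma Mconst_bounds {M0 : ℝ} (hM0 : 0 < M0) {n dn : ℕ} (X : Matrix (Fin n) (Fin dn) ℝ) :
    Xnorm X ≤ Mconst M0 X ∧ M0 * Xnorm X ≤ Mconst M0 X := by
  have h0 := Xnorm_nonneg X
  have hpos : 0 < min 1 M0⁻¹ := lt_min one_pos (inv_pos.2 hM0)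
  have h1 : 1 ≤ (min 1 M0⁻¹)⁻¹ := (one_le_inv₀ hpos).2 (min_le_left _ _)
  have h2 : M0 ≤ (min 1 M0⁻¹)⁻¹ := (le_inv_comm₀ hM0 hpos).2 (min_le_right _ _)
  refine ⟨le_mul_of_one_le_right h0 h1, ?_⟩
  rw [mul_comm, Mconst]
  gcongr

/-- The event that the empirical second moment of the noise is moderate. -/
def noiseEvent (μ : Measure ℝ) (h T A : ℝ → ℝ) {n : ℕ} (θs : Fin n → ℝ) (c : ℝ) :
    Set (Fin n → ℝ) :=
  {y | ∑ i, (T (y i) - ∫ z, T z ∂(expFamMeasure μ h T A (θs i))) ^ 2 ≤ c}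

lemma measurableSet_noiseEvent (μ : Measure ℝ) (h A : ℝ → ℝ) {T : ℝ → ℝ} (hmT : Measurable T)
    {n : ℕ} (θs : Fin n → ℝ) (c : ℝ) : MeasurableSet (noiseEvent μ h T A θs c) :=
  measurableSet_le (by fun_prop) measurable_const

lemma dataMeasure_compl_noiseEvent_le (μ : Measure ℝ) {h T A : ℝ → ℝ} (hmT : Measurable T)
    {M0 : ℝ} (hM0 : 0 < M0) {n : ℕ} (hn : 0 < n) (θs : Fin n → ℝ)
    (hprob : ∀ i, IsProbabilityMeasure (expFamMeasure μ h T A (θs i)))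
    (hvar : ∀ i, ∫⁻ y, ENNReal.ofReal ((T y - ∫ z, T z ∂(expFamMeasure μ h T A (θs i))) ^ 2)
      ∂(expFamMeasure μ h T A (θs i)) ≤ ENNReal.ofReal (M0 ^ 2 / 2)) {ℓ : ℝ} (hℓ : 0 < ℓ) :
    dataMeasure μ h T A n θs (noiseEvent μ h T A θs (n * M0 ^ 2 * ℓ))ᶜ ≤
      ENNReal.ofReal (1 / (2 * ℓ)) := by
  set V : (Fin n → ℝ) → ENNReal := fun y =>
    ∑ i, ENNReal.ofReal ((T (y i) - ∫ z, T z ∂(expFamMeasure μ h T A (θs i))) ^ 2) with hV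
  have hn' : (0 : ℝ) < n := by exact_mod_cast hn
  have hc : 0 < n * M0 ^ 2 * ℓ := by positivity
  have h1 : ∫⁻ y, V y ∂(dataMeasure μ h T A n θs) ≤ ENNReal.ofReal (n * (M0 ^ 2 / 2)) := by
    rw [hV, lintegral_finsetSum _ (fun i _ => by fun_prop)]
    calc _ ≤ ∑ _i : Fin n, ENNReal.ofReal (M0 ^ 2 / 2) := Finset.sum_le_sum fun i _ => by
          refine le_trans (le_of_eq ?_) (hvar i)
          exact (measurePreserving_eval (fun i => expFamMeasure μ h T A (θs i)) i).lintegral_comp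
            (f := fun x => ENNReal.ofReal
              ((T x - ∫ z, T z ∂(expFamMeasure μ h T A (θs i))) ^ 2)) (by fun_prop)
      _ = _ := by
          rw [Finset.sum_const, Finset.card_univ, Fintype.card_fin, ENNReal.ofReal_mul hn'.le]
          simp
  have h2 : (noiseEvent μ h T A θs (n * M0 ^ 2 * ℓ))ᶜ ⊆
      {y | ENNReal.ofReal (n * M0 ^ 2 * ℓ) ≤ V y} := fun y hy => by
    have hy' : n * M0 ^ 2 * ℓ <
      ∑ i, (T (y i) - ∫ z, T z ∂(expFamMeasure μ h T A (θs i))) ^ 2 := not_le.1 hy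
    change _ ≤ V y
    simp only [hV]
    rw [← ENNReal.ofReal_sum_of_nonneg (fun i _ => by positivity)]
    exact ENNReal.ofReal_le_ofReal hy'.le
  refine (measure_mono h2).trans ((meas_ge_le_lintegral_div (by fun_prop) (by simpa using hc)
    ENNReal.ofReal_ne_top).trans ?_)
  refine (ENNReal.div_le_div_right h1 _).trans ?_
  rw [← ENNReal.ofReal_div_of_pos hc]
  refine ENNReal.ofReal_le_ofReal (le_of_eq ?_)
  field_simp

/-- On the noise event the stochastic term is controlled by the `ℓ₁` distance. -/
lemma abs_centeredZ_le (μ : Measure ℝ) {h T A ηf : ℝ → ℝ} (hlip : LipschitzWith 1 ηf)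
    {M0 : ℝ} (hM0 : 0 < M0) {n dn : ℕ} (X : Matrix (Fin n) (Fin dn) ℝ) (βs β : Fin dn → ℝ)
    {ℓ : ℝ} (hℓ : 0 ≤ ℓ) {y : Fin n → ℝ}
    (hy : y ∈ noiseEvent μ h T A (etaVec ηf X βs) (n * M0 ^ 2 * ℓ)) :
    |centeredZ T (fun i => ∫ z, T z ∂(expFamMeasure μ h T A (etaVec ηf X βs i)))
      (etaVec ηf X βs) (etaVec ηf X β) y| ≤ n * Mconst M0 X * Real.sqrt ℓ * l1 (β - βs) := by
  have h0 := Xnorm_nonneg X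
  have h1 := l1_nonneg (β - βs)
  have hM := (Mconst_bounds hM0 X).2
  have hM' : 0 ≤ Mconst M0 X := le_trans (by positivity) hM
  refine abs_le_of_sq_le_sq ?_ (by positivity)
  refine (Finset.sum_mul_sq_le_sq_mul_sq _ _ _).trans ?_
  calc _ ≤ (n * M0 ^ 2 * ℓ) * (n * (Xnorm X * l1 (β - βs)) ^ 2) :=
        mul_le_mul hy (sum_etaVec_sub_sq_le hlip X βs β)
          (Finset.sum_nonneg fun _ _ => sq_nonneg _) (by positivity)
    _ = n ^ 2 * (M0 * Xnorm X) ^ 2 * ℓ * l1 (β - βs) ^ 2 := by ring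
    _ ≤ n ^ 2 * (Mconst M0 X) ^ 2 * ℓ * l1 (β - βs) ^ 2 := by gcongr
    _ = _ := by rw [mul_pow, mul_pow, mul_pow, Real.sq_sqrt hℓ]

lemma klDiv_etaVec_le {A ηf : ℝ → ℝ} (hlip : LipschitzWith 1 ηf) {M0 : ℝ} (hM0 : 0 < M0)
    (hbreg : ∀ s t, A (ηf t) - A (ηf s) - (ηf t - ηf s) * deriv A (ηf s) ≤
      M0 ^ 2 / 2 * (ηf t - ηf s) ^ 2)
    {n dn : ℕ} (X : Matrix (Fin n) (Fin dn) ℝ) (βs β : Fin dn → ℝ) :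
    klDiv A (etaVec ηf X βs) (etaVec ηf X β) ≤ n * (Mconst M0 X * l1 (β - βs)) ^ 2 / 2 := by
  have h0 := Xnorm_nonneg X
  have h1 := l1_nonneg (β - βs)
  have hM := (Mconst_bounds hM0 X).2
  calc klDiv A (etaVec ηf X βs) (etaVec ηf X β) ≤
        ∑ i, M0 ^ 2 / 2 * (etaVec ηf X β i - etaVec ηf X βs i) ^ 2 :=
        Finset.sum_le_sum fun i _ => hbreg _ _
    _ ≤ M0 ^ 2 / 2 * (n * (Xnorm X * l1 (β - βs)) ^ 2) := by
        rw [← Finset.mul_sum]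
        gcongr
        exact sum_etaVec_sub_sq_le hlip X βs β
    _ = n * (M0 * Xnorm X * l1 (β - βs)) ^ 2 / 2 := by ring
    _ ≤ _ := by gcongr

lemma l1_eq_restr_add {m : ℕ} (S : Finset (Fin m)) (v w : Fin m → ℝ) :
    l1 (v - w) = l1 (restr S v - restr S w) + l1 (restr Sᶜ v - restr Sᶜ w) := by
  simp only [l1, ← Finset.sum_add_distrib]
  refine Finset.sum_congr rfl fun j _ => ?_
  by_cases hj : j ∈ S <;> simp [restr, hj]

lemma l1_suppSet_sub_le {m : ℕ} (βs β : Fin m → ℝ) :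
    l1 βs - l1 β ≤ l1 (restr (suppSet βs) β - restr (suppSet βs) βs)
      - l1 (restr (suppSet βs)ᶜ β - restr (suppSet βs)ᶜ βs) := by
  simp only [l1, ← Finset.sum_sub_distrib]
  refine Finset.sum_le_sum fun j _ => ?_
  by_cases hj : βs j = 0
  · simp [restr, suppSet, hj]
  · simp only [restr, suppSet, Pi.sub_apply, Finset.mem_filter, Finset.mem_univ, true_and, ne_eq,
      hj, not_false_eq_true, if_true, Finset.mem_compl, not_true_eq_false, if_false, sub_self,
      abs_zero, sub_zero]
    have := abs_sub_abs_le_abs_sub (βs j) (β j)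
    rwa [abs_sub_comm] at this

/-- If the prior gain `e` is negative, the quadratic lower bound on the divergence dominates the
stochastic term. -/
lemma drift_le_of_compatibility {n s M φ ℓ lam u v e D : ℝ} (hn : 1 ≤ n) (hs : 0 < s) (hM : 0 < M)
    (hφ : 0 < φ) (hℓ : 0 < ℓ) (hlam : 0 < lam) (hlamM : lam ≤ M * Real.sqrt ℓ) (hu0 : 0 ≤ u)
    (hv0 : 0 ≤ v) (h0 : e < 0)
    (he : 15 * (M ^ 2 / φ ^ 2) * s * ℓ - 3 / 2 * (lam * u) + lam * v / 2 ≤ e)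
    (hD : 0 < u → v < 7 * u → n * φ ^ 2 / s * u ^ 2 ≤ D) :
    n * M * Real.sqrt ℓ * (u + v) - D ≤ e := by
  have hQ : 0 < M ^ 2 / φ ^ 2 * s * ℓ := by positivity
  have hlv : 0 ≤ lam * v := by positivity
  have hvu : v < 3 * u := by
    by_contra hcon
    linarith [mul_le_mul_of_nonneg_left (not_lt.1 hcon) hlam.le]
  have hupos : 0 < u := by linarith
  have hsq : Real.sqrt ℓ * Real.sqrt ℓ = ℓ := Real.mul_self_sqrt hℓ.le
  have hr : 0 < Real.sqrt ℓ := Real.sqrt_pos.2 hℓ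
  have hMr : 0 < M * Real.sqrt ℓ := by positivity
  have hlamu := mul_le_mul_of_nonneg_right hlamM hu0
  have hulow : 10 * M * Real.sqrt ℓ ≤ φ ^ 2 / s * u := by
    have h1 : 10 * (M ^ 2 / φ ^ 2 * s * ℓ) ≤ M * Real.sqrt ℓ * u := by linarith
    refine le_of_mul_le_mul_left ?_ hMr
    calc M * Real.sqrt ℓ * (10 * M * Real.sqrt ℓ)
        = 10 * M ^ 2 * (Real.sqrt ℓ * Real.sqrt ℓ) := by ring
      _ = φ ^ 2 / s * (10 * (M ^ 2 / φ ^ 2 * s * ℓ)) := by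
          rw [hsq]
          field_simp
      _ ≤ φ ^ 2 / s * (M * Real.sqrt ℓ * u) := by gcongr
      _ = _ := by ring
  have h2 : n * M * Real.sqrt ℓ * (u + v) ≤ n * M * Real.sqrt ℓ * (4 * u) := by
    gcongr
    linarith
  have h3 : n * u * (10 * M * Real.sqrt ℓ) ≤ n * φ ^ 2 / s * u ^ 2 := by
    calc n * u * (10 * M * Real.sqrt ℓ) ≤ n * u * (φ ^ 2 / s * u) := by gcongr
      _ = _ := by ring
  have h4 : M * Real.sqrt ℓ * u ≤ n * (M * Real.sqrt ℓ * u) :=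
    le_mul_of_one_le_left (by positivity) hn
  have h5 : 0 ≤ lam * u := by positivity
  linarith [hD hupos (by linarith)]

/-- Truncated likelihood ratio bound: the compatibility condition compensates the possible growth
of the prior density when `β` moves away from `βs`. -/
lemma setLIntegral_exp_logLR_le (μ : Measure ℝ) {h T A ηf : ℝ → ℝ} (hhpos : ∀ y, 0 ≤ h y)
    (hmh : Measurable h) (hmT : Measurable T)
    (hprob : ∀ t, IsProbabilityMeasure (expFamMeasure μ h T A (ηf t)))
    (hmean : ∀ t, ∫ y, T y ∂(expFamMeasure μ h T A (ηf t)) = deriv A (ηf t))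
    (hlip : LipschitzWith 1 ηf) {M0 : ℝ} (hM0 : 0 < M0)
    {n dn : ℕ} (hn : 0 < n) (X : Matrix (Fin n) (Fin dn) ℝ) (hM : 0 < Mconst M0 X)
    (βs β : Fin dn → ℝ) (hs : 0 < (suppSet βs).card) {φ ℓ lam : ℝ} (hφ : 0 < φ) (hℓ : 0 < ℓ)
    (hlam : 0 < lam) (hlamM : lam ≤ Mconst M0 X * Real.sqrt ℓ)
    (hIC : restr (suppSet βs) βs ≠ restr (suppSet βs) β →
        l1 (restr (suppSet βs)ᶜ β - restr (suppSet βs)ᶜ βs) <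
          7 * l1 (restr (suppSet βs) β - restr (suppSet βs) βs) →
        (n : ℝ) * φ ^ 2 / ((suppSet βs).card : ℝ) *
          l1 (restr (suppSet βs) β - restr (suppSet βs) βs) ^ 2 ≤
          klDiv A (etaVec ηf X βs) (etaVec ηf X β)) :
    ∫⁻ y in noiseEvent μ h T A (etaVec ηf X βs) (n * M0 ^ 2 * ℓ),
      ENNReal.ofReal (Real.exp (logLR μ h T A ηf X βs β y))
      ∂(dataMeasure μ h T A n (etaVec ηf X βs)) ≤
    ENNReal.ofReal (Real.exp (15 * (Mconst M0 X ^ 2 / φ ^ 2) * (suppSet βs).card * ℓ) *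
      Real.exp (-(lam * l1 βs))) *
      ENNReal.ofReal (Real.exp (lam * l1 β - lam / 2 * l1 (β - βs))) := by
  have hZ := fun y => abs_centeredZ_le μ (h := h) (T := T) (A := A) hlip hM0 X βs β hℓ.le (y := y)
  have hprob' : ∀ i, IsProbabilityMeasure (expFamMeasure μ h T A (etaVec ηf X βs i)) :=
    fun i => hprob _
  have hP : IsProbabilityMeasure (dataMeasure μ h T A n (etaVec ηf X βs)) := by
    unfold dataMeasure
    infer_instance
  have hl := l1_suppSet_sub_le βs β
  have hsplit := l1_eq_restr_add (suppSet βs) β βs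
  set u := l1 (restr (suppSet βs) β - restr (suppSet βs) βs) with hu
  set v := l1 (restr (suppSet βs)ᶜ β - restr (suppSet βs)ᶜ βs) with hv
  have hu0 : 0 ≤ u := l1_nonneg _
  have hv0 : 0 ≤ v := l1_nonneg _
  set M := Mconst M0 X
  set s : ℝ := ((suppSet βs).card : ℝ) with hsdef
  have hs' : 0 < s := Nat.cast_pos.2 hs
  have hn' : (1 : ℝ) ≤ n := by exact_mod_cast hn
  rw [← ENNReal.ofReal_mul (by positivity), ← Real.exp_add, ← Real.exp_add]
  set e := 15 * (M ^ 2 / φ ^ 2) * s * ℓ + -(lam * l1 βs) + (lam * l1 β - lam / 2 * l1 (β - βs))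
    with he
  have he' : 15 * (M ^ 2 / φ ^ 2) * s * ℓ - 3 / 2 * (lam * u) + lam * v / 2 ≤ e := by
    rw [he, hsplit]
    nlinarith [mul_le_mul_of_nonneg_left hl hlam.le]
  rcases le_or_gt 0 e with h0 | h0
  · refine (setLIntegral_le_lintegral _ _).trans
      ((lintegral_exp_logLR_le μ hhpos hmh hmT hprob hmean X βs β).trans ?_)
    rw [ENNReal.one_le_ofReal]
    exact Real.one_le_exp h0
  · have hD : 0 < u → v < 7 * u →
        n * φ ^ 2 / s * u ^ 2 ≤ klDiv A (etaVec ηf X βs) (etaVec ηf X β) := fun hupos hvu => by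
      refine hIC (fun heq => ?_) hvu
      rw [hu, heq, sub_self] at hupos
      simp [l1] at hupos
    have hdrift := drift_le_of_compatibility hn' hs' hM hφ hℓ hlam hlamM hu0 hv0 h0 he' hD
    have hpt : ∀ y ∈ noiseEvent μ h T A (etaVec ηf X βs) (n * M0 ^ 2 * ℓ),
        logLR μ h T A ηf X βs β y ≤ e := fun y hy => by
      have h1 := (le_abs_self _).trans (hZ y hy)
      rw [hsplit] at h1
      exact (sub_le_sub_right h1 _).trans hdrift
    calc _ ≤ ∫⁻ _y in noiseEvent μ h T A (etaVec ηf X βs) (n * M0 ^ 2 * ℓ),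
          ENNReal.ofReal (Real.exp e) ∂(dataMeasure μ h T A n (etaVec ηf X βs)) :=
          setLIntegral_mono' (measurableSet_noiseEvent μ h A hmT _ _) fun y hy =>
            ENNReal.ofReal_le_ofReal (Real.exp_le_exp.2 (hpt y hy))
      _ ≤ _ := by
          rw [setLIntegral_const]
          exact mul_le_of_le_one_right' prob_le_one

lemma modelMeasure_card_suppSet_gt {dn : ℕ} (lam : ℝ) (S : Finset (Fin dn)) {K : ℝ}
    (hS : (S.card : ℝ) ≤ K) :
    modelMeasure dn lam S {β | K < ((suppSet β).card : ℝ)} = 0 := by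
  have hsub : {β : Fin dn → ℝ | K < ((suppSet β).card : ℝ)} ⊆
      ⋃ j : {j // j ∉ S}, (fun β : Fin dn → ℝ => β j) ⁻¹' {0}ᶜ := fun β hβ => by
    by_contra hcon
    simp only [Set.mem_iUnion, not_exists, Subtype.forall] at hcon
    have : suppSet β ⊆ S := fun j hj => by
      by_contra hjS
      exact hcon j hjS (by simpa [suppSet] using hj)
    have h1 : ((suppSet β).card : ℝ) ≤ S.card := by exact_mod_cast Finset.card_le_card this
    exact absurd (h1.trans hS) (not_le.2 hβ)
  refine measure_mono_null hsub (measure_iUnion_null fun j => ?_)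
  exact Measure.pi_eval_preimage_null _ (by simp [j.2])

/-- Integrals against the prior over large models decompose into a sum over model sizes. -/
lemma setLIntegral_priorMeasure_le {dn : ℕ} {lam a C K R x : ℝ} (hC : 0 ≤ C) (hR : 0 ≤ R)
    (hlam : 0 < lam) (b : Fin dn → ℝ)
    (hx : ∀ p : ℕ, K < p → (2 : ℝ) ^ p * ((dn : ℝ) ^ (-a)) ^ p ≤ x) (hx0 : 0 ≤ x) :
    ∫⁻ β in {β | K < ((suppSet β).card : ℝ)}, ENNReal.ofReal R *
      ENNReal.ofReal (Real.exp (lam * l1 β - lam / 2 * l1 (β - b)))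
      ∂(priorMeasure dn lam a C) ≤ ENNReal.ofReal (R * C * (dn + 1) * x) := by
  set B : Set (Fin dn → ℝ) := {β | K < ((suppSet β).card : ℝ)}
  rw [priorMeasure, ← Measure.restrictₗ_apply, map_sum, lintegral_finsetSum_measure]
  have hterm : ∀ S : Finset (Fin dn), ∫⁻ β, ENNReal.ofReal R *
      ENNReal.ofReal (Real.exp (lam * l1 β - lam / 2 * l1 (β - b)))
      ∂(Measure.restrictₗ B (ENNReal.ofReal
        (C * ((dn.choose S.card : ℝ))⁻¹ * ((dn : ℝ) ^ (-a)) ^ S.card) • modelMeasure dn lam S)) ≤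
      ENNReal.ofReal (C * ((dn.choose S.card : ℝ))⁻¹ * R * x) := fun S => by
    rw [Measure.restrictₗ_apply, Measure.restrict_smul, lintegral_smul_measure,
      lintegral_const_mul' _ _ ENNReal.ofReal_ne_top]
    rcases le_or_gt (S.card : ℝ) K with hS | hS
    · rw [Measure.restrict_eq_zero.2 (modelMeasure_card_suppSet_gt lam S hS)]
      simp
    · calc _ ≤ ENNReal.ofReal (C * ((dn.choose S.card : ℝ))⁻¹ * ((dn : ℝ) ^ (-a)) ^ S.card) •
            (ENNReal.ofReal R * 2 ^ S.card) := by
            gcongr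
            exact (setLIntegral_le_lintegral _ _).trans
              (lintegral_modelMeasure_recentred_le hlam S b)
        _ = ENNReal.ofReal (C * ((dn.choose S.card : ℝ))⁻¹ * R *
            (2 ^ S.card * ((dn : ℝ) ^ (-a)) ^ S.card)) := by
            have h2 : (2 : ENNReal) ^ S.card = ENNReal.ofReal (2 ^ S.card) := by
              rw [ENNReal.ofReal_pow (by norm_num)]
              norm_num
            rw [smul_eq_mul, h2, ← ENNReal.ofReal_mul hR, ← ENNReal.ofReal_mul (by positivity)]
            ring_nf
        _ ≤ _ := by
            gcongr
            exact hx _ hS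
  refine (Finset.sum_le_sum fun S _ => hterm S).trans (le_of_eq ?_)
  rw [← ENNReal.ofReal_sum_of_nonneg (fun S _ => by positivity)]
  congr 1
  have h1 := Finset.sum_powerset_apply_card
    (fun m => C * ((dn.choose m : ℝ))⁻¹ * R * x) (x := (Finset.univ : Finset (Fin dn)))
  rw [Finset.powerset_univ, Finset.card_univ, Fintype.card_fin] at h1
  rw [h1]
  calc _ = ∑ m ∈ Finset.range (dn + 1), R * C * x := by
        refine Finset.sum_congr rfl fun m hm => ?_
        have : (dn.choose m : ℝ) ≠ 0 := by
          exact_mod_cast (Nat.choose_pos (Nat.lt_succ_iff.1 (Finset.mem_range.1 hm))).ne'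
        rw [nsmul_eq_mul]
        field_simp
    _ = _ := by
        rw [Finset.sum_const, Finset.card_range, nsmul_eq_mul]
        push_cast
        ring

lemma two_pow_mul_rpow_pow_le {D a Q : ℝ} {s p : ℕ} (hD : 0 < D) (hℓ : 1 ≤ Real.log D) (ha : 1 < a)
    (hQ : 0 ≤ Q) (hs : 0 < s) (hp : s * (1 + 8 / (a - 1) * (1 + 49 * Q / 8)) < p) :
    (2 : ℝ) ^ p * (D ^ (-a)) ^ p ≤
      Real.exp (-((3 + a * s + 4 * s + 15 * Q * s) * Real.log D)) := by
  have h2 : (2 : ℝ) ^ p = Real.exp (p * Real.log 2) := by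
    rw [Real.exp_nat_mul, Real.exp_log two_pos]
  rw [Real.rpow_def_of_pos hD, ← Real.exp_nat_mul, h2, ← Real.exp_add, Real.exp_le_exp]
  have hs' : (1 : ℝ) ≤ s := by exact_mod_cast hs
  have ha' : 0 < a - 1 := by linarith
  have h3 : (8 + 49 * Q) * s ≤ (a - 1) * (p - s) := by
    calc (8 + 49 * Q) * s = (a - 1) * (s * (1 + 8 / (a - 1) * (1 + 49 * Q / 8)) - s) := by
          field_simp
          ring
      _ ≤ _ := by gcongr
  have h4 : 3 + 5 * s + 15 * Q * s ≤ (a - 1) * (p - s) := by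
    nlinarith [mul_nonneg hQ (zero_le_one.trans hs')]
  have h5 : p * Real.log 2 ≤ p * Real.log D := by
    exact mul_le_mul_of_nonneg_left (by linarith [Real.log_two_lt_d9]) (Nat.cast_nonneg p)
  linarith [mul_le_mul_of_nonneg_right h4 (zero_le_one.trans hℓ)]

lemma l1_sub_le_of_mem_modelBox {dn : ℕ} {S : Finset (Fin dn)} {b β : Fin dn → ℝ} {r : ℝ}
    (hb : ∀ j ∉ S, b j = 0) (hβ : β ∈ modelBox S b r) : l1 (β - b) ≤ S.card * r := by
  calc l1 (β - b) ≤ ∑ j, if j ∈ S then r else 0 := Finset.sum_le_sum fun j _ => by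
        have h1 : β j ∈ if j ∈ S then Set.Icc (b j - r) (b j + r) else {0} := hβ j (Set.mem_univ j)
        split_ifs with hj
        · rw [if_pos hj] at h1
          exact abs_le.2 ⟨by simp only [Pi.sub_apply]; linarith [h1.1],
            by simp only [Pi.sub_apply]; linarith [h1.2]⟩
        · rw [if_neg hj] at h1
          simp [hb j hj, Set.mem_singleton_iff.1 h1]
    _ = S.card * r := by simp

/-- Each model bounds integrals against the prior from below. -/
lemma le_lintegral_priorMeasure {dn : ℕ} (lam a C : ℝ) (S : Finset (Fin dn))
    (f : (Fin dn → ℝ) → ENNReal) :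
    ENNReal.ofReal (C * ((dn.choose S.card : ℝ))⁻¹ * ((dn : ℝ) ^ (-a)) ^ S.card) *
      ∫⁻ β, f β ∂(modelMeasure dn lam S) ≤ ∫⁻ β, f β ∂(priorMeasure dn lam a C) := by
  rw [priorMeasure, lintegral_finsetSum_measure]
  refine le_trans (le_of_eq ?_) (Finset.single_le_sum
    (f := fun S => ∫⁻ β, f β ∂(ENNReal.ofReal (C * ((dn.choose S.card : ℝ))⁻¹ *
      ((dn : ℝ) ^ (-a)) ^ S.card) • modelMeasure dn lam S))
    (fun _ _ => zero_le) (Finset.mem_univ S))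
  simp only [lintegral_smul_measure, smul_eq_mul]

lemma prior_box_coefficient_ge {D C a q ℓ w E : ℝ} {s : ℕ} {binom : ℝ} (hC : 0 ≤ C)
    (hD : D = Real.exp ℓ) (hℓ : 9 ≤ ℓ) (hb0 : 0 < binom) (hb : binom ≤ D ^ s)
    (hq : Real.exp (-(2 * ℓ)) ≤ q) (hq' : q ≤ Real.sqrt ℓ) (hE : 0 ≤ E)
    (hw : w = s * Real.sqrt ℓ + s) :
    C * E * Real.exp (-((a * s + 4 * s) * ℓ)) ≤
      C * binom⁻¹ * (D ^ (-a)) ^ s *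
        (Real.exp (-w) * ((q * Real.exp (-q)) ^ s * E)) := by
  have hq0 : 0 ≤ q := (Real.exp_pos _).le.trans hq
  have h1 : Real.exp (-(s * ℓ)) ≤ binom⁻¹ := by
    rw [Real.exp_neg, Real.exp_nat_mul, ← hD]
    gcongr
  have h2 : (D ^ (-a)) ^ s = Real.exp (-(s * (a * ℓ))) := by
    rw [hD, ← Real.exp_mul, ← Real.exp_nat_mul]
    ring_nf
  have h3 : Real.exp (s * (-(2 * ℓ) - Real.sqrt ℓ)) ≤ (q * Real.exp (-q)) ^ s := by
    rw [Real.exp_nat_mul, sub_eq_add_neg, Real.exp_add]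
    gcongr
  have h4 : 2 * Real.sqrt ℓ + 1 ≤ ℓ := by
    have h5 : 3 ≤ Real.sqrt ℓ := Real.le_sqrt_of_sq_le (by linarith)
    nlinarith [Real.mul_self_sqrt (show (0 : ℝ) ≤ ℓ by linarith)]
  rw [h2]
  calc C * E * Real.exp (-((a * s + 4 * s) * ℓ))
      ≤ C * E * Real.exp (-(s * ℓ) + -(s * (a * ℓ)) + -w + s * (-(2 * ℓ) - Real.sqrt ℓ)) := by
        gcongr
        rw [hw]
        linarith [mul_le_mul_of_nonneg_left h4 (Nat.cast_nonneg (α := ℝ) s)]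
    _ = C * Real.exp (-(s * ℓ)) * Real.exp (-(s * (a * ℓ))) *
        (Real.exp (-w) * (Real.exp (s * (-(2 * ℓ) - Real.sqrt ℓ)) * E)) := by
        rw [Real.exp_add, Real.exp_add, Real.exp_add]
        ring
    _ ≤ _ := by gcongr

/-- Lower bound for the marginal likelihood on the noise event. -/
lemma le_marginalLik (μ : Measure ℝ) {h T A ηf : ℝ → ℝ} (hlip : LipschitzWith 1 ηf) {M0 : ℝ}
    (hM0 : 0 < M0)
    (hbreg : ∀ s t, A (ηf t) - A (ηf s) - (ηf t - ηf s) * deriv A (ηf s) ≤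
      M0 ^ 2 / 2 * (ηf t - ηf s) ^ 2)
    {n dn : ℕ} (hn : 0 < n) (hdn : n < dn) (X : Matrix (Fin n) (Fin dn) ℝ) (hM : 0 < Mconst M0 X)
    (βs : Fin dn → ℝ) (hsn : (suppSet βs).card ≤ n) (hℓ : 9 ≤ Real.log dn) {lam a C : ℝ}
    (hC : 0 ≤ C) (hlam : Mconst M0 X / dn ≤ lam)
    (hlamM : lam ≤ Mconst M0 X * Real.sqrt (Real.log dn)) {y : Fin n → ℝ}
    (hy : y ∈ noiseEvent μ h T A (etaVec ηf X βs) (n * M0 ^ 2 * Real.log dn))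
    (hint : Integrable (fun β => Real.exp (logLR μ h T A ηf X βs β y))
      (priorMeasure dn lam a C)) :
    C * Real.exp (-(lam * l1 βs)) *
      Real.exp (-((a * (suppSet βs).card + 4 * (suppSet βs).card) * Real.log dn)) ≤
      marginalLik μ h T A ηf dn X βs lam a C y := by
  have hn' : (1 : ℝ) ≤ n := by exact_mod_cast hn
  have hdn' : (n : ℝ) ≤ dn := by exact_mod_cast hdn.le
  have hd0 : (0 : ℝ) < dn := by linarith
  have hlam0 : 0 < lam := lt_of_lt_of_le (by positivity) hlam
  have hsn' : ((suppSet βs).card : ℝ) ≤ n := by exact_mod_cast hsn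
  set M := Mconst M0 X with hMdef
  set S := suppSet βs with hS
  set ℓ := Real.log dn with hℓdef
  have hb : ∀ j ∉ S, βs j = 0 := fun j hj => by simpa [hS, suppSet] using hj
  set r := (n * M)⁻¹ with hr
  have hr0 : 0 < r := by positivity
  have hbox : ∀ β ∈ modelBox S βs r,
      -(S.card * Real.sqrt ℓ + S.card) ≤ logLR μ h T A ηf X βs β y := fun β hβ => by
    have h1 := l1_sub_le_of_mem_modelBox hb hβ
    have h0 := l1_nonneg (β - βs)
    have h2 := (abs_le.1 (abs_centeredZ_le μ hlip hM0 X βs β (by linarith) hy)).1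
    have h3 := klDiv_etaVec_le hlip hM0 hbreg X βs β
    have h4 : n * M * Real.sqrt ℓ * l1 (β - βs) ≤ S.card * Real.sqrt ℓ := by
      calc _ ≤ n * M * Real.sqrt ℓ * (S.card * r) := by gcongr
        _ = _ := by
          rw [hr]
          field_simp
    have h5 : n * (M * l1 (β - βs)) ^ 2 / 2 ≤ (S.card : ℝ) := by
      calc n * (M * l1 (β - βs)) ^ 2 / 2 ≤ n * (M * (S.card * r)) ^ 2 / 2 := by gcongr
        _ = (S.card : ℝ) * S.card / (2 * n) := by
          rw [hr]
          field_simp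
        _ ≤ (S.card : ℝ) * n / (2 * n) := by gcongr
        _ = (S.card : ℝ) / 2 := by field_simp
        _ ≤ S.card := by linarith [Nat.cast_nonneg (α := ℝ) S.card]
    have h6 : logLR μ h T A ηf X βs β y = _ - _ := rfl
    rw [h6]
    linarith
  have hq : Real.exp (-(2 * ℓ)) ≤ lam * r := by
    rw [Real.exp_neg, two_mul, Real.exp_add, hℓdef, Real.exp_log hd0, hr, mul_inv, mul_inv]
    calc (dn : ℝ)⁻¹ * (dn : ℝ)⁻¹ ≤ (dn : ℝ)⁻¹ * (n : ℝ)⁻¹ := by gcongr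
      _ = M / dn * ((n : ℝ)⁻¹ * M⁻¹) := by field_simp
      _ ≤ _ := by gcongr
  have hq' : lam * r ≤ Real.sqrt ℓ := by
    calc lam * r ≤ M * Real.sqrt ℓ * r := by gcongr
      _ = Real.sqrt ℓ / n := by
        rw [hr]
        field_simp
      _ ≤ Real.sqrt ℓ := div_le_self (Real.sqrt_nonneg _) hn'
  have hchoose : 0 < dn.choose S.card := Nat.choose_pos (hsn.trans hdn.le)
  have hnn : 0 ≤ marginalLik μ h T A ηf dn X βs lam a C y :=
    integral_nonneg fun β => (Real.exp_pos _).le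
  refine (ENNReal.ofReal_le_ofReal_iff hnn).1 ?_
  rw [marginalLik, ofReal_integral_eq_lintegral_ofReal hint
    (ae_of_all _ fun β => (Real.exp_pos _).le)]
  refine le_trans ?_ (le_lintegral_priorMeasure lam a C S _)
  calc _ ≤ ENNReal.ofReal (C * ((dn.choose S.card : ℝ))⁻¹ * ((dn : ℝ) ^ (-a)) ^ S.card) *
        (ENNReal.ofReal (Real.exp (-(S.card * Real.sqrt ℓ + S.card))) * ENNReal.ofReal
          ((lam * r * Real.exp (-(lam * r))) ^ S.card * Real.exp (-(lam * l1 βs)))) := by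
        rw [← ENNReal.ofReal_mul (by positivity), ← ENNReal.ofReal_mul (by positivity)]
        refine ENNReal.ofReal_le_ofReal ?_
        exact prior_box_coefficient_ge hC (Real.exp_log hd0).symm hℓ (by exact_mod_cast hchoose)
          (by exact_mod_cast Nat.choose_le_pow dn S.card) hq hq' (by positivity) rfl
    _ ≤ _ := by
        gcongr
        calc _ ≤ ∫⁻ _β in modelBox S βs r,
              ENNReal.ofReal (Real.exp (-(S.card * Real.sqrt ℓ + S.card)))
              ∂(modelMeasure dn lam S) := by
              rw [setLIntegral_const]
              gcongr
              exact le_modelMeasure_modelBox hlam0 hr0.le S hb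
          _ ≤ _ := (setLIntegral_mono' (measurableSet_modelBox S βs r) fun β hβ =>
              ENNReal.ofReal_le_ofReal (Real.exp_le_exp.2 (hbox β hβ))).trans
              (setLIntegral_le_lintegral _ _)

lemma measurable_logLR (μ : Measure ℝ) (h : ℝ → ℝ) {T A ηf : ℝ → ℝ} (hmT : Measurable T)
    (hη : Measurable ηf) (hAη : Measurable fun t => A (ηf t)) {n dn : ℕ}
    (X : Matrix (Fin n) (Fin dn) ℝ) (βs : Fin dn → ℝ) :
    Measurable fun p : (Fin n → ℝ) × (Fin dn → ℝ) => logLR μ h T A ηf X βs p.2 p.1 := by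
  have h1 : ∀ i, Measurable fun p : (Fin n → ℝ) × (Fin dn → ℝ) => ∑ j, X i j * p.2 j :=
    fun i => by fun_prop
  have h2 : ∀ i, Measurable fun p : (Fin n → ℝ) × (Fin dn → ℝ) => etaVec ηf X p.2 i :=
    fun i => hη.comp (h1 i)
  have h3 : ∀ i, Measurable fun p : (Fin n → ℝ) × (Fin dn → ℝ) => A (etaVec ηf X p.2 i) :=
    fun i => hAη.comp (h1 i)
  unfold logLR centeredZ klDiv
  refine (Finset.measurable_sum _ fun i _ => ?_).sub (Finset.measurable_sum _ fun i _ => ?_)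
  · exact ((hmT.comp (by fun_prop)).sub_const _).mul ((h2 i).sub_const _)
  · exact ((h3 i).sub_const _).sub (((h2 i).sub_const _).mul_const _)

lemma lintegral_numerator_le (μ : Measure ℝ) {h T A ηf : ℝ → ℝ} (hmT : Measurable T)
    (hη : Measurable ηf) (hAη : Measurable fun t => A (ηf t)) {n dn : ℕ}
    (X : Matrix (Fin n) (Fin dn) ℝ) (βs : Fin dn → ℝ) {lam a C K R x : ℝ} (hC : 0 ≤ C)
    (hR : 0 ≤ R) (hlam : 0 < lam) [SFinite (priorMeasure dn lam a C)]
    [SFinite (dataMeasure μ h T A n (etaVec ηf X βs))] (G : Set (Fin n → ℝ))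
    (hG : ∀ β, ∫⁻ y in G, ENNReal.ofReal (Real.exp (logLR μ h T A ηf X βs β y))
      ∂(dataMeasure μ h T A n (etaVec ηf X βs)) ≤
      ENNReal.ofReal R * ENNReal.ofReal (Real.exp (lam * l1 β - lam / 2 * l1 (β - βs))))
    (hx : ∀ p : ℕ, K < p → (2 : ℝ) ^ p * ((dn : ℝ) ^ (-a)) ^ p ≤ x) (hx0 : 0 ≤ x) :
    ∫⁻ y in G, ∫⁻ β in {β | K < ((suppSet β).card : ℝ)},
      ENNReal.ofReal (Real.exp (logLR μ h T A ηf X βs β y)) ∂(priorMeasure dn lam a C)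
      ∂(dataMeasure μ h T A n (etaVec ηf X βs)) ≤ ENNReal.ofReal (R * C * (dn + 1) * x) := by
  rw [lintegral_lintegral_swap
    (measurable_logLR μ h hmT hη hAη X βs).exp.ennreal_ofReal.aemeasurable]
  exact (lintegral_mono hG).trans (setLIntegral_priorMeasure_le hC hR hlam βs hx hx0)

lemma posterior_mem_Icc (μ : Measure ℝ) (h T A ηf : ℝ → ℝ) {n dn : ℕ}
    (X : Matrix (Fin n) (Fin dn) ℝ) (βs : Fin dn → ℝ) (lam a C : ℝ) (B : Set (Fin dn → ℝ))
    (y : Fin n → ℝ) :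
    posterior μ h T A ηf dn X βs lam a C B y ∈ Set.Icc 0 1 := by
  have h0 : 0 ≤ marginalLik μ h T A ηf dn X βs lam a C y :=
    integral_nonneg fun _ => (Real.exp_pos _).le
  refine ⟨div_nonneg (integral_nonneg fun _ => (Real.exp_pos _).le) h0, ?_⟩
  by_cases hint : Integrable (fun β => Real.exp (logLR μ h T A ηf X βs β y))
      (priorMeasure dn lam a C)
  · exact div_le_one_of_le₀
      (setIntegral_le_integral hint (ae_of_all _ fun _ => (Real.exp_pos _).le)) h0
  · rw [posterior, marginalLik, integral_undef hint, div_zero]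
    exact zero_le_one

lemma ofReal_posterior_le (μ : Measure ℝ) (h T A ηf : ℝ → ℝ) {n dn : ℕ}
    (X : Matrix (Fin n) (Fin dn) ℝ) (βs : Fin dn → ℝ) (lam a C : ℝ) (B : Set (Fin dn → ℝ))
    (y : Fin n → ℝ) {c : ℝ} (hc : 0 < c)
    (hlow : Integrable (fun β => Real.exp (logLR μ h T A ηf X βs β y)) (priorMeasure dn lam a C) →
      c ≤ marginalLik μ h T A ηf dn X βs lam a C y) :
    ENNReal.ofReal (posterior μ h T A ηf dn X βs lam a C B y) ≤
      (∫⁻ β in B, ENNReal.ofReal (Real.exp (logLR μ h T A ηf X βs β y))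
        ∂(priorMeasure dn lam a C)) * (ENNReal.ofReal c)⁻¹ := by
  by_cases hint : Integrable (fun β => Real.exp (logLR μ h T A ηf X βs β y))
      (priorMeasure dn lam a C)
  · rw [← ofReal_integral_eq_lintegral_ofReal hint.integrableOn
      (ae_of_all _ fun _ => (Real.exp_pos _).le), ← div_eq_mul_inv, ← ENNReal.ofReal_div_of_pos hc]
    refine ENNReal.ofReal_le_ofReal ?_
    rw [posterior]
    have : 0 ≤ ∫ β in B, Real.exp (logLR μ h T A ηf X βs β y) ∂(priorMeasure dn lam a C) :=
      integral_nonneg fun _ => (Real.exp_pos _).le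
    gcongr
    exact hlow hint
  · rw [posterior, marginalLik, integral_undef hint, div_zero]
    simp

lemma integral_le_of_ratio_bound {Ω : Type*} [MeasurableSpace Ω] {P : Measure Ω}
    {f : Ω → ℝ} {N : Ω → ENNReal} {G : Set Ω} (hG : MeasurableSet G) (hf : ∀ y, f y ∈ Set.Icc 0 1)
    {c ε₁ ε₂ : ℝ} (hc : 0 < c) (hε₁ : 0 ≤ ε₁) (hε₂ : 0 ≤ ε₂)
    (hfN : ∀ y ∈ G, ENNReal.ofReal (f y) ≤ N y * (ENNReal.ofReal c)⁻¹)
    (hGc : P Gᶜ ≤ ENNReal.ofReal ε₁) (hN : ∫⁻ y in G, N y ∂P ≤ ENNReal.ofReal (c * ε₂)) :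
    ∫ y, f y ∂P ≤ ε₁ + ε₂ := by
  by_cases hint : Integrable f P
  · rw [← ENNReal.ofReal_le_ofReal_iff (add_nonneg hε₁ hε₂),
      ofReal_integral_eq_lintegral_ofReal hint (ae_of_all _ fun y => (hf y).1),
      ← lintegral_add_compl _ hG, add_comm, ENNReal.ofReal_add hε₁ hε₂]
    have hc' : ENNReal.ofReal c ≠ 0 := (ENNReal.ofReal_pos.2 hc).ne'
    gcongr
    · calc _ ≤ ∫⁻ _y in Gᶜ, 1 ∂P := lintegral_mono fun y => by
            rw [ENNReal.ofReal_le_one]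
            exact (hf y).2
        _ ≤ _ := by simpa using hGc
    · calc _ ≤ ∫⁻ y in G, N y * (ENNReal.ofReal c)⁻¹ ∂P := setLIntegral_mono' hG hfN
        _ = (∫⁻ y in G, N y ∂P) * (ENNReal.ofReal c)⁻¹ :=
            lintegral_mul_const' _ _ (ENNReal.inv_ne_top.2 hc')
        _ ≤ ENNReal.ofReal (c * ε₂) * (ENNReal.ofReal c)⁻¹ := by gcongr
        _ = ENNReal.ofReal ε₂ := by
            rw [ENNReal.ofReal_mul hc.le, mul_comm (ENNReal.ofReal c), mul_assoc,
              ENNReal.mul_inv_cancel hc' ENNReal.ofReal_ne_top, mul_one]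
  · rw [integral_undef hint]
    positivity

/-- Non-asymptotic bound on the expected posterior probability of large supports. -/
lemma integral_posterior_card_gt_le (μ : Measure ℝ) {h T A ηf : ℝ → ℝ} (hhpos : ∀ y, 0 ≤ h y)
    (hmh : Measurable h) (hmT : Measurable T)
    (hprob : ∀ t, IsProbabilityMeasure (expFamMeasure μ h T A (ηf t)))
    (hmean : ∀ t, ∫ y, T y ∂(expFamMeasure μ h T A (ηf t)) = deriv A (ηf t))
    {M0 : ℝ} (hM0 : 0 < M0)
    (hvar : ∀ t, ∫⁻ y, ENNReal.ofReal ((T y - ∫ z, T z ∂(expFamMeasure μ h T A (ηf t))) ^ 2)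
      ∂(expFamMeasure μ h T A (ηf t)) ≤ ENNReal.ofReal (M0 ^ 2 / 2))
    (hlip : LipschitzWith 1 ηf) (hAη : Measurable fun t => A (ηf t))
    (hbreg : ∀ s t, A (ηf t) - A (ηf s) - (ηf t - ηf s) * deriv A (ηf s) ≤
      M0 ^ 2 / 2 * (ηf t - ηf s) ^ 2)
    {n dn : ℕ} (hn : 0 < n) (hdn : n < dn) (X : Matrix (Fin n) (Fin dn) ℝ) (hM : 0 < Mconst M0 X)
    (βs : Fin dn → ℝ) (hs : 0 < (suppSet βs).card) (hsn : (suppSet βs).card ≤ n)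
    (hℓ : 9 ≤ Real.log dn) {lam a C φ : ℝ} (ha : 1 < a) (hC : 0 < C) (hφ : 0 < φ)
    (hlam : Mconst M0 X / dn ≤ lam) (hlamM : lam ≤ Mconst M0 X * Real.sqrt (Real.log dn))
    [IsProbabilityMeasure (priorMeasure dn lam a C)]
    (hIC : ∀ β, restr (suppSet βs) βs ≠ restr (suppSet βs) β →
        l1 (restr (suppSet βs)ᶜ β - restr (suppSet βs)ᶜ βs) <
          7 * l1 (restr (suppSet βs) β - restr (suppSet βs) βs) →
        (n : ℝ) * φ ^ 2 / ((suppSet βs).card : ℝ) *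
          l1 (restr (suppSet βs) β - restr (suppSet βs) βs) ^ 2 ≤
          klDiv A (etaVec ηf X βs) (etaVec ηf X β)) :
    ∫ y, posterior μ h T A ηf dn X βs lam a C
        {β | ((suppSet βs).card : ℝ) *
          (1 + 8 / (a - 1) * (1 + 49 * Mconst M0 X ^ 2 / (8 * φ ^ 2))) <
          ((suppSet β).card : ℝ)} y ∂(dataMeasure μ h T A n (etaVec ηf X βs)) ≤
      1 / (2 * Real.log dn) + 2 / dn := by
  have hprob' : ∀ i, IsProbabilityMeasure (expFamMeasure μ h T A (etaVec ηf X βs i)) :=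
    fun i => hprob _
  have hP : IsProbabilityMeasure (dataMeasure μ h T A n (etaVec ηf X βs)) := by
    unfold dataMeasure
    infer_instance
  have hd1 : (1 : ℝ) ≤ dn := by exact_mod_cast (Nat.zero_lt_of_lt hdn)
  have hd0 : (0 : ℝ) < dn := by linarith
  have hlam0 : 0 < lam := lt_of_lt_of_le (by positivity) hlam
  have hℓ0 : 0 < Real.log dn := by linarith
  refine integral_le_of_ratio_bound
    (measurableSet_noiseEvent μ h A hmT (etaVec ηf X βs) (n * M0 ^ 2 * Real.log dn))
    (fun y => posterior_mem_Icc μ h T A ηf X βs lam a C _ y)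
    (c := C * Real.exp (-(lam * l1 βs)) *
      Real.exp (-((a * (suppSet βs).card + 4 * (suppSet βs).card) * Real.log dn)))
    (by positivity) (by positivity) (by positivity)
    (fun y hy => ofReal_posterior_le μ h T A ηf X βs lam a C _ y (by positivity)
      (le_marginalLik μ hlip hM0 hbreg hn hdn X hM βs hsn hℓ hC.le hlam hlamM hy))
    (dataMeasure_compl_noiseEvent_le μ hmT hM0 hn (etaVec ηf X βs) hprob' (fun i => hvar _) hℓ0)
    ?_
  refine (lintegral_numerator_le μ hmT hlip.continuous.measurable hAη X βs
    (x := Real.exp (-((3 + a * (suppSet βs).card + 4 * (suppSet βs).card +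
      15 * (Mconst M0 X ^ 2 / φ ^ 2) * (suppSet βs).card) * Real.log dn)))
    hC.le (by positivity) hlam0 _ (fun β =>
      setLIntegral_exp_logLR_le μ hhpos hmh hmT hprob hmean hlip hM0 hn X hM βs β hs hφ hℓ0 hlam0
        hlamM (hIC β)) (fun p hp => ?_) (Real.exp_pos _).le).trans (ENNReal.ofReal_le_ofReal ?_)
  · refine two_pow_mul_rpow_pow_le hd0 (by linarith) ha (by positivity) hs (lt_of_eq_of_lt ?_ hp)
    ring
  · set s : ℝ := ((suppSet βs).card : ℝ)
    set ℓ := Real.log dn with hℓd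
    have h3 : Real.exp (3 * ℓ) = (dn : ℝ) ^ 3 := by
      rw [← Real.exp_log hd0, ← Real.exp_nat_mul]
      norm_num [hℓd]
    calc _ = C * Real.exp (-(lam * l1 βs)) * (dn + 1) *
          (Real.exp (15 * (Mconst M0 X ^ 2 / φ ^ 2) * s * ℓ) *
          Real.exp (-((3 + a * s + 4 * s + 15 * (Mconst M0 X ^ 2 / φ ^ 2) * s) * ℓ))) := by ring
      _ = C * Real.exp (-(lam * l1 βs)) * (dn + 1) *
          (Real.exp (-((a * s + 4 * s) * ℓ)) * (Real.exp (3 * ℓ))⁻¹) := by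
          rw [← Real.exp_add, ← Real.exp_neg, ← Real.exp_add]
          ring_nf
      _ = C * Real.exp (-(lam * l1 βs)) * Real.exp (-((a * s + 4 * s) * ℓ)) *
          ((dn + 1) / (dn : ℝ) ^ 3) := by
          rw [h3]
          ring
      _ ≤ _ := by
          refine mul_le_mul_of_nonneg_left ?_ (by positivity)
          rw [div_le_div_iff₀ (by positivity) hd0]
          nlinarith [mul_pos hd0 hd0, mul_le_mul_of_nonneg_left hd1 (mul_pos hd0 hd0).le]

/-- The compatibility condition at a nonzero vector forces the design to be nonzero. -/
lemma Mconst_pos_of_compatibility {A ηf : ℝ → ℝ} (hlip : LipschitzWith 1 ηf) {M0 : ℝ}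
    (hM0 : 0 < M0)
    (hbreg : ∀ s t, A (ηf t) - A (ηf s) - (ηf t - ηf s) * deriv A (ηf s) ≤
      M0 ^ 2 / 2 * (ηf t - ηf s) ^ 2)
    {n dn : ℕ} (hn : 0 < n) (X : Matrix (Fin n) (Fin dn) ℝ) (βs : Fin dn → ℝ)
    (hs : 0 < (suppSet βs).card) {φ : ℝ} (hφ : 0 < φ)
    (hIC : ∀ β, restr (suppSet βs) βs ≠ restr (suppSet βs) β →
        l1 (restr (suppSet βs)ᶜ β - restr (suppSet βs)ᶜ βs) <
          7 * l1 (restr (suppSet βs) β - restr (suppSet βs) βs) →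
        (n : ℝ) * φ ^ 2 / ((suppSet βs).card : ℝ) *
          l1 (restr (suppSet βs) β - restr (suppSet βs) βs) ^ 2 ≤
          klDiv A (etaVec ηf X βs) (etaVec ηf X β)) :
    0 < Mconst M0 X := by
  refine lt_of_le_of_ne ((Xnorm_nonneg X).trans (Mconst_bounds hM0 X).1) fun h0 => ?_
  obtain ⟨j, hj⟩ := Finset.card_pos.1 hs
  have hj' : βs j ≠ 0 := by simpa [suppSet] using hj
  have hu : 0 < l1 (restr (suppSet βs) 0 - restr (suppSet βs) βs) :=
    Finset.sum_pos' (fun _ _ => abs_nonneg _) ⟨j, Finset.mem_univ j, by simpa [restr, hj] using hj'⟩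
  have hv : l1 (restr (suppSet βs)ᶜ 0 - restr (suppSet βs)ᶜ βs) = 0 :=
    Finset.sum_eq_zero fun i _ => by
      by_cases hi : βs i = 0 <;> simp [restr, suppSet, hi]
  have h1 := hIC 0 (fun heq => by simpa [restr, hj, hj'] using congrFun heq j) (by linarith)
  have h2 := klDiv_etaVec_le hlip hM0 hbreg X βs 0
  rw [← h0] at h2
  have h3 : 0 < (n : ℝ) * φ ^ 2 / ((suppSet βs).card : ℝ) *
      l1 (restr (suppSet βs) 0 - restr (suppSet βs) βs) ^ 2 := by
    have : (0 : ℝ) < n := by exact_mod_cast hn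
    positivity
  simp only [zero_mul, ne_eq, OfNat.ofNat_ne_zero, not_false_eq_true, zero_pow, mul_zero,
    zero_div] at h2
  linarith

/-- **Theorem 2** (bound on the effective dimension of the posterior). -/
theorem theorem2_posterior_dimension
    (μ : Measure ℝ) [SigmaFinite μ]
    (h T A ηf : ℝ → ℝ) (M0 : ℝ) (hM0 : 0 < M0)
    (domA : Set ℝ) (hdomA : Convex ℝ domA) (hrange : ∀ t : ℝ, ηf t ∈ domA)
    (hconv : ConvexOn ℝ domA A) (hsmooth : ContDiffOn ℝ 2 A domA)
    (hhpos : ∀ y, 0 ≤ h y) (hmh : Measurable h) (hmT : Measurable T)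
    (hlogpart : ∀ θ ∈ domA, Real.exp (A θ) = ∫ y, h y * Real.exp (θ * T y) ∂μ)
    (hprob : ∀ θ ∈ domA, IsProbabilityMeasure (expFamMeasure μ h T A θ))
    (hIA : ∀ c : ℝ, 0 < c →
      ({t : ℝ | 0 ≤ deriv (deriv A) t ∧ deriv (deriv A) t ≤ c} : Set ℝ).OrdConnected)
    (hIAtop : ({t : ℝ | 0 ≤ deriv (deriv A) t} : Set ℝ).OrdConnected)
    (hclip : ∀ t : ℝ, 0 ≤ deriv (deriv A) (ηf t) ∧ deriv (deriv A) (ηf t) ≤ M0 ^ 2 / 2)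
    (hlip : LipschitzWith 1 ηf) (hinj : Function.Injective ηf)
    (d : ℕ → ℕ) (hdgt : ∀ n, n < d n)
    (hdinf : Tendsto (fun n => (d n : ℝ)) atTop atTop)
    (b : ℕ → ℝ) (hbpos : ∀ n, 0 < b n)
    (hbo : Tendsto (fun n => b n * Real.log (d n) / n) atTop (nhds 0))
    (X : ∀ n : ℕ, Matrix (Fin n) (Fin (d n)) ℝ)
    (lam a C : ℕ → ℝ) (hCpos : ∀ n, 0 < C n)
    (hL0 : ∀ n, Mconst M0 (X n) / (d n : ℝ) ≤ lam n ∧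
      lam n ≤ Mconst M0 (X n) * Real.sqrt (Real.log (d n)))
    (hprior : ∀ n, IsProbabilityMeasure (priorMeasure (d n) (lam n) (a n) (C n)))
    (φ1 : ∀ n : ℕ, Finset (Fin (d n)) → ℝ)
    (hICmodel : ∀ n : ℕ, ∀ S : Finset (Fin (d n)), 0 < φ1 n S →
      ∀ β1 β2 : Fin (d n) → ℝ, restr S β1 ≠ restr S β2 →
        l1 (restr Sᶜ β2 - restr Sᶜ β1) < 7 * l1 (restr S β2 - restr S β1) →
        (n : ℝ) * φ1 n S ^ 2 / (S.card : ℝ) * l1 (restr S β2 - restr S β1) ^ 2 ≤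
          klDiv A (etaVec ηf (X n) β1) (etaVec ηf (X n) β2))
    (hICmodelEx : ∀ n : ℕ, ∃ S : Finset (Fin (d n)), S.Nonempty ∧ 0 < φ1 n S)
    (hICjoint : ∀ n : ℕ, (Bset d b φ1 n).Nonempty)
    (ha : ∀ n, 1 < a n) :
    Tendsto (fun n : ℕ =>
      ⨆ βs ∈ Bset d b φ1 n,
        ∫ y, posterior μ h T A ηf (d n) (X n) βs (lam n) (a n) (C n)
            {β | ((suppSet βs).card : ℝ) *
                (1 + 8 / (a n - 1) *
                  (1 + 49 * Mconst M0 (X n) ^ 2 / (8 * φ1 n (suppSet βs) ^ 2))) <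
              ((suppSet β).card : ℝ)} y
          ∂(dataMeasure μ h T A n (etaVec ηf (X n) βs)))
      atTop (nhds 0) := by
  have hcont : Continuous ηf := hlip.continuous
  have hint : ∀ t, ηf t ∈ interior domA :=
    mem_interior_of_injective_continuous hcont hinj hdomA hrange
  have hJ : (Set.range ηf).OrdConnected := (isPreconnected_range hcont).ordConnected
  have hmv := fun t => expFam_mean_variance μ hhpos hmh hmT hlogpart (hint t)
  have hAη : Measurable fun t => A (ηf t) :=
    (hsmooth.continuousOn.comp_continuous hcont hrange).measurable
  have hbreg : ∀ s t, A (ηf t) - A (ηf s) - (ηf t - ηf s) * deriv A (ηf s) ≤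
      M0 ^ 2 / 2 * (ηf t - ηf s) ^ 2 := fun s t =>
    bregman_le hJ (Set.range_subset_iff.2 hint) hsmooth (Set.forall_mem_range.2 hclip)
      (Set.mem_range_self s) (Set.mem_range_self t)
  have hlog : Tendsto (fun n => Real.log (d n)) atTop atTop := Real.tendsto_log_atTop.comp hdinf
  have hlim : Tendsto (fun n => 1 / (2 * Real.log (d n)) + 2 / (d n : ℝ)) atTop (nhds 0) := by
    have h1 : Tendsto (fun n => 2 * Real.log (d n)) atTop atTop :=
      hlog.const_mul_atTop two_pos
    simpa using (h1.const_div_atTop 1).add (hdinf.const_div_atTop 2)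
  refine tendsto_of_tendsto_of_tendsto_of_le_of_le' tendsto_const_nhds hlim
    (Eventually.of_forall fun n => Real.iSup_nonneg fun βs => Real.iSup_nonneg fun _ =>
      integral_nonneg fun y => (posterior_mem_Icc μ h T A ηf (X n) βs _ _ _ _ y).1) ?_
  filter_upwards [eventually_gt_atTop 0, hlog.eventually_ge_atTop 9,
    hbo.eventually_lt_const zero_lt_one] with n hn hℓ hb1
  have hbound : 0 ≤ 1 / (2 * Real.log (d n)) + 2 / (d n : ℝ) := by
    have : 0 < Real.log (d n) := by linarith
    positivity
  refine Real.iSup_le (fun βs => Real.iSup_le (fun hβs => ?_) hbound) hbound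
  obtain ⟨hφ, hs, hsb⟩ := hβs
  have hn' : (0 : ℝ) < n := by exact_mod_cast hn
  have hsn : (suppSet βs).card ≤ n := by
    rw [div_lt_one hn'] at hb1
    have : ((suppSet βs).card : ℝ) ≤ n := by nlinarith
    exact_mod_cast this
  have hM : 0 < Mconst M0 (X n) :=
    Mconst_pos_of_compatibility hlip hM0 hbreg hn (X n) βs hs hφ (hICmodel n _ hφ βs)
  have := hprior n
  exact integral_posterior_card_gt_le μ hhpos hmh hmT (fun t => hprob _ (hrange t))
    (fun t => (hmv t).1) hM0
    (fun t => (hmv t).2.trans_le (ENNReal.ofReal_le_ofReal (hclip t).2)) hlip hAη hbreg hn (hdgt n)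
    (X n) hM βs hs hsn hℓ (ha n) (hCpos n) hφ (hL0 n).1 (hL0 n).2 (hICmodel n _ hφ βs)
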